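/- Row and column independence: let X be a standard Borel space, let p be a row-column exchangeable probability measure on ℕ × ℕ → X, and fix n ∈ ℕ with 𝒜 = {0,…,n−1}. Then under p, the 2n σ-algebras ℱ_{{i} × 𝒜ᶜ} for i ∈ 𝒜 (the row tails) together with ℱ_{𝒜ᶜ × {j}} for j ∈ 𝒜 (the column tails) are mutually conditionally independent given the σ-algebra ℱ_{𝒜ᶜ × 𝒜ᶜ} (the tail of the array). -/

import Mathlib

open MeasureTheory ProbabilityTheory

/-- A measure on `ℕ × ℕ → X` is row-column exchangeable if for every permutation `σ` of `ℕ`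
fixing all but finitely many elements, it is invariant under permuting the rows by `σ` and
under permuting the columns by `σ`. -/
def RowColumnExchangeable {X : Type*} [MeasurableSpace X]
    (p : Measure (ℕ × ℕ → X)) : Prop :=
  ∀ σ : Equiv.Perm ℕ, {n | σ n ≠ n}.Finite →
    p.map (fun x (ij : ℕ × ℕ) => x (σ ij.1, ij.2)) = p ∧
    p.map (fun x (ij : ℕ × ℕ) => x (ij.1, σ ij.2)) = p

/-- The sub-σ-algebra `ℱ_S` of `ℕ × ℕ → X` generated by the coordinate projections
`x ↦ x (i, j)` for `(i, j) ∈ S`. -/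
def coordSigma (X : Type*) [mX : MeasurableSpace X] (S : Set (ℕ × ℕ)) :
    MeasurableSpace (ℕ × ℕ → X) :=
  ⨆ ij ∈ S, mX.comap (fun x => x ij)

lemma coordSigma_le (X : Type*) [MeasurableSpace X] (S : Set (ℕ × ℕ)) :
    coordSigma X S ≤ MeasurableSpace.pi :=
  iSup₂_le fun ij _ => (measurable_pi_apply ij).comap_le

/-- The set `𝒜 = {0, …, n-1} ⊆ ℕ`. -/
def blk (n : ℕ) : Set ℕ := {k | k < n}

lemma condExp_ae_eq_of_comp_eq {Ω : Type*} {m₁ m₂ mΩ : MeasurableSpace Ω} {μ : Measure Ω}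
    [IsFiniteMeasure μ] (h12 : m₁ ≤ m₂) (h2 : m₂ ≤ mΩ) {Φ : Ω → Ω}
    (hΦ : MeasurePreserving Φ μ μ) (hΦm : Measurable[m₁, m₂] Φ) {f : Ω → ℝ}
    (hf : MemLp f 2 μ) (hfΦ : f ∘ Φ = f) : μ[f | m₂] =ᵐ[μ] μ[f | m₁] := by
  set g : Ω → ℝ := μ[f | m₂] with hg_def
  set k : Ω → ℝ := g ∘ Φ with hk_def
  have hg : MemLp g 2 μ := hf.condExp one_le_two
  have hk : MemLp k 2 μ := hg.comp_measurePreserving hΦ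
  have hgm : StronglyMeasurable[m₂] g := stronglyMeasurable_condExp
  have hkm : StronglyMeasurable[m₁] k := hgm.comp_measurable hΦm
  have hfg : MemLp (f - g) 2 μ := hf.sub hg
  have hgk : MemLp (g - k) 2 μ := hg.sub hk
  have hcross_int : Integrable ((f - g) * (g - k)) μ := hfg.integrable_mul hgk
  have hcross : ∫ x, ((f - g) * (g - k)) x ∂μ = 0 := by
    have h1 : μ[(f - g) * (g - k) | m₂] =ᵐ[μ] 0 := by
      have h3 := condExp_mul_of_stronglyMeasurable_right (hgm.sub (hkm.mono h12)) hcross_int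
        (hfg.integrable one_le_two)
      have h4 := condExp_sub (m := m₂) (hf.integrable one_le_two) (hg.integrable one_le_two)
      have h5 : μ[g | m₂] = g :=
        condExp_of_stronglyMeasurable h2 hgm (hg.integrable one_le_two)
      filter_upwards [h3, h4] with x hx hy
      rw [hx, Pi.mul_apply, hy, h5]
      simp [hg_def]
    rw [← integral_condExp h2, integral_congr_ae h1]
    simp
  have hinv : ∫ x, (f x - k x) ^ 2 ∂μ = ∫ x, (f x - g x) ^ 2 ∂μ := by
    have hasm : AEStronglyMeasurable (fun x => (f x - g x) ^ 2) (μ.map Φ) := by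
      rw [hΦ.map_eq]
      exact hfg.aestronglyMeasurable.pow 2
    have h := integral_map hΦ.measurable.aemeasurable hasm
    rw [hΦ.map_eq] at h
    rw [h]
    refine integral_congr_ae (Filter.Eventually.of_forall fun x => ?_)
    have : f (Φ x) = f x := congrFun hfΦ x
    simp [hk_def, this]
  have hexp : ∫ x, (f x - k x) ^ 2 ∂μ
      = ∫ x, (f x - g x) ^ 2 ∂μ + ∫ x, (g x - k x) ^ 2 ∂μ := by
    have h1 : ∀ x, (f x - k x) ^ 2
        = ((f x - g x) ^ 2 + (g x - k x) ^ 2) + 2 * ((f - g) * (g - k)) x := by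
      intro x
      simp only [Pi.mul_apply, Pi.sub_apply]
      ring
    have i1 : Integrable (fun x => (f x - g x) ^ 2) μ := hfg.integrable_sq
    have i2 : Integrable (fun x => (g x - k x) ^ 2) μ := hgk.integrable_sq
    have i12 : Integrable (fun x => (f x - g x) ^ 2 + (g x - k x) ^ 2) μ := i1.add i2
    simp_rw [h1]
    rw [integral_add i12 (hcross_int.const_mul 2), integral_add i1 i2, integral_const_mul, hcross]
    ring
  have hgk_ae : g =ᵐ[μ] k := by
    have h0 : ∫ x, (g - k) x ^ 2 ∂μ = 0 := by
      simp only [Pi.sub_apply]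
      linarith
    rw [integral_eq_zero_iff_of_nonneg (fun x => sq_nonneg _) hgk.integrable_sq] at h0
    filter_upwards [h0] with x hx
    have : (g - k) x = 0 := by simpa using hx
    rw [Pi.sub_apply] at this
    linarith
  have h3 : μ[g | m₁] =ᵐ[μ] μ[f | m₁] := condExp_condExp_of_le h12 h2
  have h4 : μ[g | m₁] =ᵐ[μ] μ[k | m₁] := condExp_congr_ae hgk_ae
  have h5 : μ[k | m₁] = k :=
    condExp_of_stronglyMeasurable (h12.trans h2) hkm (hk.integrable one_le_two)
  exact hgk_ae.trans ((h5 ▸ h4.symm).trans h3)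

lemma condIndep_of_condExp_ae_eq {Ω : Type*} {m' m₁ m₂ m₃ mΩ : MeasurableSpace Ω}
    [StandardBorelSpace Ω] {μ : Measure Ω} [IsFiniteMeasure μ] (hm' : m' ≤ mΩ)
    (h₁ : m₁ ≤ mΩ) (hm₃ : m' ≤ m₃) (h23 : m₂ ≤ m₃) (h₃ : m₃ ≤ mΩ)
    (h : ∀ t, MeasurableSet[m₁] t → μ⟦t | m₃⟧ =ᵐ[μ] μ⟦t | m'⟧) :
    CondIndep m' m₁ m₂ hm' μ := by
  rw [condIndep_iff _ _ _ hm' h₁ (h23.trans h₃)]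
  intro t₁ t₂ ht₁ ht₂
  set f₁ : Ω → ℝ := t₁.indicator fun _ => 1 with hf₁
  set f₂ : Ω → ℝ := t₂.indicator fun _ => 1 with hf₂
  have hi₁ : Integrable f₁ μ := (integrable_const 1).indicator (h₁ _ ht₁)
  have hi₂ : Integrable f₂ μ := (integrable_const 1).indicator (h₃ _ (h23 _ ht₂))
  have hs₂ : StronglyMeasurable[m₃] f₂ := stronglyMeasurable_const.indicator (h23 _ ht₂)
  have hmul : ∀ f : Ω → ℝ, f * f₂ = t₂.indicator f := by
    intro f
    ext x
    by_cases hx : x ∈ t₂ <;> simp [hf₂, hx]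
  have hprod : (t₁ ∩ t₂).indicator (fun _ => (1 : ℝ)) = f₁ * f₂ := by
    rw [hmul, hf₁, Set.indicator_indicator, Set.inter_comm]
  have hint : ∀ f : Ω → ℝ, Integrable f μ → Integrable (f * f₂) μ := by
    intro f hf
    rw [hmul]
    exact hf.indicator (h₃ _ (h23 _ ht₂))
  have e1 : μ[f₁ * f₂ | m₃] =ᵐ[μ] μ[f₁ | m'] * f₂ :=
    (condExp_mul_of_stronglyMeasurable_right hs₂ (hint _ hi₁) hi₁).trans
      ((h t₁ ht₁).mul (ae_eq_refl f₂))
  have e2 : μ[μ[f₁ | m'] * f₂ | m'] =ᵐ[μ] μ[f₁ | m'] * μ[f₂ | m'] :=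
    condExp_mul_of_stronglyMeasurable_left stronglyMeasurable_condExp
      (hint _ integrable_condExp) hi₂
  rw [hprod]
  exact (condExp_condExp_of_le hm₃ h₃).symm.trans ((condExp_congr_ae e1).trans e2)

lemma iCondIndep_of_condIndep_le {Ω ι : Type*} {m' mΩ : MeasurableSpace Ω}
    [StandardBorelSpace Ω] {μ : Measure Ω} [IsFiniteMeasure μ] (hm' : m' ≤ mΩ)
    (m M : ι → MeasurableSpace Ω) (hm : ∀ i, m i ≤ mΩ) (hM : ∀ i, M i ≤ mΩ)
    (hmM : ∀ i j, j ≠ i → m j ≤ M i) (h : ∀ i, CondIndep m' (m i) (M i) hm' μ) :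
    iCondIndep m' hm' m μ := by
  classical
  rw [iCondIndep_iff _ _ _ hm]
  intro s f
  induction s using Finset.induction_on with
  | empty =>
    intro _
    simp only [Finset.notMem_empty, Set.iInter_of_empty, Set.iInter_univ, Finset.prod_empty,
      Set.indicator_univ]
    rw [condExp_const hm']
    rfl
  | insert a s ha ih =>
    intro hf
    rw [Finset.set_biInter_insert, Finset.prod_insert ha]
    have hs : MeasurableSet[M a] (⋂ i ∈ s, f i) := by
      refine Finset.measurableSet_biInter s fun i hi => ?_
      exact hmM a i (fun hia => ha (hia ▸ hi)) _ (hf i (Finset.mem_insert_of_mem hi))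
    have h1 := (condIndep_iff _ _ _ hm' (hm a) (hM a) μ).1 (h a) (f a) _
      (hf a (Finset.mem_insert_self a s)) hs
    exact h1.trans ((ae_eq_refl _).mul (ih fun i hi => hf i (Finset.mem_insert_of_mem hi)))

lemma exists_perm_finite_support_eqOn {τ : ℕ → ℕ} (hτ : τ.Injective) (J : Finset ℕ) :
    ∃ a : Equiv.Perm ℕ, {n | a n ≠ n}.Finite ∧ ∀ j ∈ J, a j = τ j := by
  obtain ⟨N, hN⟩ := (J ∪ J.image τ).bddAbove
  have hlt : ∀ j ∈ J, j < N + 1 ∧ τ j < N + 1 := fun j hj =>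
    ⟨Nat.lt_succ_of_le (hN (by simp [hj])),
      Nat.lt_succ_of_le (hN (by
        simp only [Finset.coe_union, Finset.coe_image]
        exact Or.inr ⟨j, hj, rfl⟩))⟩
  obtain ⟨b, hb⟩ := Equiv.Perm.exists_extending_pair (α := J) (β := {k // k < N + 1})
    (fun j => ⟨j, (hlt j j.2).1⟩) (fun j => ⟨τ j, (hlt j j.2).2⟩)
    (fun i j hij => Subtype.ext (Subtype.mk.inj hij))
    (fun i j hij => Subtype.ext (hτ (Subtype.mk.inj hij)))
  refine ⟨Equiv.Perm.ofSubtype b, (Set.finite_lt_nat (N + 1)).subset fun k hk => ?_,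
    fun j hj => ?_⟩
  · by_contra hkN
    exact hk (Equiv.Perm.ofSubtype_apply_of_not_mem b hkN)
  · rw [Equiv.Perm.ofSubtype_apply_of_mem b (hlt j hj).1, hb ⟨j, hj⟩]

lemma RowColumnExchangeable.measurePreserving {X : Type*} [MeasurableSpace X]
    {p : Measure (ℕ × ℕ → X)} [IsProbabilityMeasure p] (hp : RowColumnExchangeable p)
    {τ σ : ℕ → ℕ} (hτ : τ.Injective) (hσ : σ.Injective) :
    MeasurePreserving (fun x (ij : ℕ × ℕ) => x (τ ij.1, σ ij.2)) p p := by
  have hmeas : ∀ τ σ : ℕ → ℕ,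
      Measurable fun (x : ℕ × ℕ → X) (ij : ℕ × ℕ) => x (τ ij.1, σ ij.2) := fun τ σ => by fun_prop
  refine ⟨hmeas τ σ, ?_⟩
  refine IsProjectiveLimit.unique (P := fun I => p.map I.restrict) (fun I => ?_) fun I => rfl
  obtain ⟨a, ha, haτ⟩ := exists_perm_finite_support_eqOn hτ (I.image Prod.fst)
  obtain ⟨b, hb, hbσ⟩ := exists_perm_finite_support_eqOn hσ (I.image Prod.snd)
  have hab : p.map (fun x (ij : ℕ × ℕ) => x (a ij.1, b ij.2)) = p := by
    conv_rhs => rw [← (hp b hb).2, ← (hp a ha).1]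
    exact (Measure.map_map (hmeas id b) (hmeas a id)).symm
  conv_rhs => rw [← hab]
  rw [Measure.map_map (Finset.measurable_restrict I) (hmeas τ σ)]
  beta_reduce
  rw [Measure.map_map (Finset.measurable_restrict I) (hmeas a b)]
  congr 1
  ext x ij
  have h1 := haτ ij.1.1 (Finset.mem_image_of_mem _ ij.2)
  have h2 := hbσ ij.1.2 (Finset.mem_image_of_mem _ ij.2)
  simp [h1, h2]

section coordSigma

variable {X : Type*} [MeasurableSpace X]

lemma coordSigma_mono {S T : Set (ℕ × ℕ)} (h : S ⊆ T) : coordSigma X S ≤ coordSigma X T :=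
  biSup_mono h

lemma measurable_coordSigma_comp {φ : ℕ × ℕ → ℕ × ℕ} {S T : Set (ℕ × ℕ)}
    (h : Set.MapsTo φ T S) :
    Measurable[coordSigma X S, coordSigma X T] fun x ij => x (φ ij) := by
  rw [measurable_iff_comap_le, coordSigma, MeasurableSpace.comap_iSup]
  refine iSup_le fun ij => ?_
  rw [MeasurableSpace.comap_iSup]
  refine iSup_le fun hij => ?_
  rw [MeasurableSpace.comap_comp]
  exact le_iSup₂_of_le (φ ij) (h hij) le_rfl

lemma preimage_comp_eq_of_measurableSet_coordSigma {φ : ℕ × ℕ → ℕ × ℕ} {S : Set (ℕ × ℕ)}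
    (h : ∀ ij ∈ S, φ ij = ij) {t : Set (ℕ × ℕ → X)} (ht : MeasurableSet[coordSigma X S] t) :
    (fun x ij => x (φ ij)) ⁻¹' t = t := by
  have hle : coordSigma X S ≤
      MeasurableSpace.invariants fun (x : ℕ × ℕ → X) (ij : ℕ × ℕ) => x (φ ij) := by
    refine iSup₂_le fun ij hij => ?_
    rintro _ ⟨B, hB, rfl⟩
    refine MeasurableSpace.measurableSet_invariants.2 ⟨measurable_pi_apply ij hB, ?_⟩
    ext x
    simp [h ij hij]
  exact (MeasurableSpace.measurableSet_invariants.1 (hle _ ht)).2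

lemma RowColumnExchangeable.condExp_ae_eq {p : Measure (ℕ × ℕ → X)} [IsProbabilityMeasure p]
    (hp : RowColumnExchangeable p) {τ σ : ℕ → ℕ} (hτ : τ.Injective) (hσ : σ.Injective)
    {S U V : Set (ℕ × ℕ)} (hUV : U ⊆ V) (hV : Set.MapsTo (Prod.map τ σ) V U)
    (hS : ∀ ij ∈ S, Prod.map τ σ ij = ij) {t : Set (ℕ × ℕ → X)}
    (ht : MeasurableSet[coordSigma X S] t) :
    p⟦t | coordSigma X V⟧ =ᵐ[p] p⟦t | coordSigma X U⟧ := by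
  refine condExp_ae_eq_of_comp_eq (coordSigma_mono hUV) (coordSigma_le X V)
    (hp.measurePreserving hτ hσ) (measurable_coordSigma_comp hV)
    (memLp_indicator_const 2 (coordSigma_le X S _ ht) 1 (Or.inr (measure_ne_top p t))) ?_
  change ((fun (x : ℕ × ℕ → X) ij => x (Prod.map τ σ ij)) ⁻¹' t).indicator (fun _ => (1 : ℝ)) = _
  exact congrArg (Set.indicator · _) (preimage_comp_eq_of_measurableSet_coordSigma hS ht)

lemma coordSigma_iUnion {κ : Type*} (S : κ → Set (ℕ × ℕ)) :
    coordSigma X (⋃ k, S k) = ⨆ k, coordSigma X (S k) :=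
  iSup_iUnion _ _

lemma RowColumnExchangeable.condIndep [StandardBorelSpace X] {p : Measure (ℕ × ℕ → X)}
    [IsProbabilityMeasure p] (hp : RowColumnExchangeable p) {τ σ : ℕ → ℕ → ℕ}
    (hτ : ∀ N, (τ N).Injective) (hσ : ∀ N, (σ N).Injective) {S : ℕ → Set (ℕ × ℕ)}
    (hSmono : Monotone S) {U V : Set (ℕ × ℕ)} (hUV : U ⊆ V)
    (hV : ∀ N, Set.MapsTo (Prod.map (τ N) (σ N)) V U)
    (hS : ∀ N, ∀ ij ∈ S N, Prod.map (τ N) (σ N) ij = ij) :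
    CondIndep (coordSigma X U) (coordSigma X (⋃ N, S N)) (coordSigma X V)
      (coordSigma_le X U) p := by
  rw [coordSigma_iUnion]
  refine condIndep_iSup_of_monotone (fun N => ?_) (fun N => coordSigma_le X _)
    (coordSigma_le X V) fun N M h => coordSigma_mono (hSmono h)
  exact condIndep_of_condExp_ae_eq _ (coordSigma_le X _) (coordSigma_mono hUV) le_rfl
    (coordSigma_le X V) fun t ht => hp.condExp_ae_eq (hτ N) (hσ N) hUV (hV N) (hS N) ht

end coordSigma

/-- Fixes every element of `D` and translates the others by `m`. -/
noncomputable def shiftOff (D : Set ℕ) (m : ℕ) (k : ℕ) : ℕ :=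
  open Classical in if k ∈ D then k else k + m

lemma shiftOff_of_mem {D : Set ℕ} {m k : ℕ} (h : k ∈ D) : shiftOff D m k = k := if_pos h

lemma shiftOff_of_notMem {D : Set ℕ} {m k : ℕ} (h : k ∉ D) : shiftOff D m k = k + m := if_neg h

lemma shiftOff_injective {D : Set ℕ} {m : ℕ} (h : ∀ k ∈ D, k < m) :
    (shiftOff D m).Injective := by
  intro i j hij
  by_cases hi : i ∈ D <;> by_cases hj : j ∈ D <;>
    simp only [shiftOff, hi, hj, if_true, if_false] at hij
  · exact hij
  · have := h i hi
    omega
  · have := h j hj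
    omega
  · omega

lemma le_shiftOff {D : Set ℕ} {n m k : ℕ} (hD : ∀ k ∈ D, n ≤ k) (hm : n ≤ m) :
    n ≤ shiftOff D m k := by
  by_cases hk : k ∈ D
  · rw [shiftOff_of_mem hk]
    exact hD k hk
  · rw [shiftOff_of_notMem hk]
    omega

lemma compl_blk_eq_iUnion (n : ℕ) : (blk n)ᶜ = ⋃ N, Set.Ico n (n + N) := by
  ext k
  simp only [blk, Set.mem_compl_iff, Set.mem_ofPred_eq, not_lt, Set.mem_iUnion, Set.mem_Ico]
  exact ⟨fun h => ⟨k + 1, h, by omega⟩, fun ⟨_, h, _⟩ => h⟩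

lemma le_shiftOff_singleton {n i k : ℕ} (h : k ≠ i) : n ≤ shiftOff {i} (n + i + 1) k := by
  rw [shiftOff_of_notMem (by simpa using h)]
  omega

lemma mem_compl_blk {n k : ℕ} : k ∈ (blk n)ᶜ ↔ n ≤ k := by
  simp [blk]

lemma monotone_Ico_add (n : ℕ) : Monotone fun N => Set.Ico n (n + N) :=
  fun _ _ h => Set.Ico_subset_Ico_right (Nat.add_le_add_left h n)

section

variable {X : Type*} [MeasurableSpace X] [StandardBorelSpace X] {p : Measure (ℕ × ℕ → X)}
  [IsProbabilityMeasure p]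

lemma RowColumnExchangeable.condIndep_row (hp : RowColumnExchangeable p) {n i : ℕ}
    (hi : i < n) :
    CondIndep (coordSigma X ((blk n)ᶜ ×ˢ (blk n)ᶜ)) (coordSigma X ({i} ×ˢ (blk n)ᶜ))
      (coordSigma X ({i}ᶜ ×ˢ Set.univ)) (coordSigma_le X _) p := by
  have hS : ({i} : Set ℕ) ×ˢ (blk n)ᶜ = ⋃ N, ({i} : Set ℕ) ×ˢ Set.Ico n (n + N) := by
    rw [compl_blk_eq_iUnion, Set.prod_iUnion]
  rw [hS]
  refine hp.condIndep (τ := fun _ => shiftOff {i} (n + i + 1))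
    (σ := fun N => shiftOff (Set.Ico n (n + N)) (n + N))
    (fun _ => shiftOff_injective (by simp)) (fun N => shiftOff_injective fun k hk => hk.2)
    (fun _ _ h => Set.prod_mono le_rfl (monotone_Ico_add n h)) ?_ ?_ ?_
  · rintro ⟨a, b⟩ ⟨ha, -⟩
    refine ⟨fun h => ?_, trivial⟩
    rw [mem_compl_blk] at ha
    obtain rfl : a = i := h
    omega
  · rintro N ⟨a, b⟩ ⟨ha, -⟩
    exact ⟨mem_compl_blk.2 (le_shiftOff_singleton ha),
      mem_compl_blk.2 (le_shiftOff (fun k hk => hk.1) (by omega))⟩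
  · rintro N ⟨a, b⟩ ⟨ha, hb⟩
    exact Prod.ext (shiftOff_of_mem ha) (shiftOff_of_mem hb)

lemma RowColumnExchangeable.condIndep_column (hp : RowColumnExchangeable p) {n j : ℕ}
    (hj : j < n) :
    CondIndep (coordSigma X ((blk n)ᶜ ×ˢ (blk n)ᶜ)) (coordSigma X ((blk n)ᶜ ×ˢ {j}))
      (coordSigma X (Set.univ ×ˢ {j}ᶜ)) (coordSigma_le X _) p := by
  have hS : (blk n)ᶜ ×ˢ ({j} : Set ℕ) = ⋃ N, Set.Ico n (n + N) ×ˢ ({j} : Set ℕ) := by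
    rw [compl_blk_eq_iUnion, Set.iUnion_prod_const]
  rw [hS]
  refine hp.condIndep (σ := fun _ => shiftOff {j} (n + j + 1))
    (τ := fun N => shiftOff (Set.Ico n (n + N)) (n + N))
    (fun N => shiftOff_injective fun k hk => hk.2) (fun _ => shiftOff_injective (by simp))
    (fun _ _ h => Set.prod_mono (monotone_Ico_add n h) le_rfl) ?_ ?_ ?_
  · rintro ⟨a, b⟩ ⟨-, hb⟩
    refine ⟨trivial, fun h => ?_⟩
    rw [mem_compl_blk] at hb
    obtain rfl : b = j := h
    omega
  · rintro N ⟨a, b⟩ ⟨-, hb⟩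
    exact ⟨mem_compl_blk.2 (le_shiftOff (fun k hk => hk.1) (by omega)),
      mem_compl_blk.2 (le_shiftOff_singleton hb)⟩
  · rintro N ⟨a, b⟩ ⟨ha, hb⟩
    exact Prod.ext (shiftOff_of_mem ha) (shiftOff_of_mem hb)

end


/-- **Row and column independence**: let `p` be a row-column exchangeable probability
measure on `ℕ × ℕ → X` (`X` standard Borel) and `𝒜 = {0,…,n-1}`.  Then under `p` the `2n`
σ-algebras `ℱ_{{i} × 𝒜ᶜ}` for `i ∈ 𝒜` (the row tails) together with `ℱ_{𝒜ᶜ × {j}}` for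
`j ∈ 𝒜` (the column tails) are mutually conditionally independent given the σ-algebra
`ℱ_{𝒜ᶜ × 𝒜ᶜ}` (the tail of the array). -/
theorem row_and_column_independence
    {X : Type*} [MeasurableSpace X] [StandardBorelSpace X]
    (p : Measure (ℕ × ℕ → X)) [IsProbabilityMeasure p]
    (hp : RowColumnExchangeable p) (n : ℕ) :
    iCondIndep
      (coordSigma X ((blk n)ᶜ ×ˢ (blk n)ᶜ))
      (coordSigma_le X _)
      (fun k : Fin n ⊕ Fin n =>
        Sum.elim (fun i : Fin n => coordSigma X ({(i : ℕ)} ×ˢ (blk n)ᶜ))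
          (fun j : Fin n => coordSigma X ((blk n)ᶜ ×ˢ {(j : ℕ)})) k) p := by
  refine iCondIndep_of_condIndep_le _ _
    (fun k => Sum.elim (fun i : Fin n => coordSigma X ({(i : ℕ)}ᶜ ×ˢ Set.univ))
      (fun j : Fin n => coordSigma X (Set.univ ×ˢ {(j : ℕ)}ᶜ)) k) ?_ ?_ ?_ ?_
  · rintro (i | j) <;> exact coordSigma_le X _
  · rintro (i | j) <;> exact coordSigma_le X _
  · rintro (i | i) (j | j) hne <;> refine coordSigma_mono ?_ <;> rintro ⟨a, b⟩ ⟨ha, hb⟩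
    · obtain rfl : a = j := ha
      exact ⟨fun h => hne (congrArg Sum.inl (Fin.ext h)), trivial⟩
    · refine ⟨fun h => ?_, trivial⟩
      obtain rfl : a = i := h
      exact ha i.2
    · refine ⟨trivial, fun h => ?_⟩
      obtain rfl : b = i := h
      exact hb i.2
    · obtain rfl : b = j := hb
      exact ⟨trivial, fun h => hne (congrArg Sum.inr (Fin.ext h))⟩
  · rintro (i | j)
    · exact hp.condIndep_row i.2
    · exact hp.condIndep_column j.2
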